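/- Let b be a rational function in the closed unit ball of H∞ with ‖b‖∞ = 1 that is not a finite Blaschke product. Let φ ∈ H(b) ∩ ball(H∞) with φ(ξ_j) ∈ Z_T(a) for 1 ≤ j ≤ p and φ(ξ_j) ∈ D for p+1 ≤ j ≤ n. If the composition operator C_φ is bounded on H(b), then the function u = (a₁ ∘ φ) · ∏_{j=p+1}^n (φ − φ(ξ_j))^{m_j} / a₁ belongs to the Hardy space H². -/

import Mathlib

open Complex MeasureTheory Set Filter

noncomputable section

attribute [local instance] Classical.propDecidable

/-- The open unit disk in `ℂ`. -/
def unitDisk : Set ℂ := Metric.ball 0 1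

/-- The unit circle in `ℂ`. -/
def unitCircle : Set ℂ := Metric.sphere 0 1

/-- Membership in `H^∞`: analytic and bounded on the unit disk. -/
def MemHinf (f : ℂ → ℂ) : Prop :=
  DifferentiableOn ℂ f unitDisk ∧ ∃ C : ℝ, ∀ z ∈ unitDisk, ‖f z‖ ≤ C

/-- Membership in the closed unit ball of `H^∞`. -/
def MemBallHinf (f : ℂ → ℂ) : Prop :=
  DifferentiableOn ℂ f unitDisk ∧ ∀ z ∈ unitDisk, ‖f z‖ ≤ 1

/-- `f` agrees on the closed unit disk with a rational function without poles there. -/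
def IsRationalOnDisk (f : ℂ → ℂ) : Prop :=
  ∃ P Q : Polynomial ℂ, ∀ z ∈ Metric.closedBall (0:ℂ) 1,
    Q.eval z ≠ 0 ∧ f z = P.eval z / Q.eval z

/-- `f` is a finite Blaschke product (multiplicities are encoded by repetition). -/
def IsFiniteBlaschke (f : ℂ → ℂ) : Prop :=
  ∃ (γ : ℂ) (k : ℕ) (lam : Fin k → ℂ), ‖γ‖ = 1 ∧ (∀ i, lam i ∈ unitDisk) ∧
    ∀ z ∈ unitDisk, f z = γ * ∏ i, (z - lam i) / (1 - (starRingEnd ℂ) (lam i) * z)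

/-- The `k`-th Taylor coefficient of `f` at the origin. -/
def taylorCoeff (f : ℂ → ℂ) (k : ℕ) : ℂ := iteratedDeriv k f 0 / k.factorial

/-- Membership in the Hardy space `H²` (square-summable Taylor coefficients). -/
def MemH2 (f : ℂ → ℂ) : Prop :=
  DifferentiableOn ℂ f unitDisk ∧ Summable fun k => ‖taylorCoeff f k‖ ^ 2

/-- The squared `H²` norm. -/
def h2NormSq (f : ℂ → ℂ) : ℝ := ∑' k, ‖taylorCoeff f k‖ ^ 2

/-- The `H²` inner product. -/
def h2Inner (f g : ℂ → ℂ) : ℂ :=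
  ∑' k, (starRingEnd ℂ) (taylorCoeff f k) * taylorCoeff g k

/-- The polynomial `a₁(z) = ∏ⱼ (z − ξⱼ)^{mⱼ}`. -/
def a1fun {n : ℕ} (ξ : Fin n → ℂ) (m : Fin n → ℕ) : ℂ → ℂ :=
  fun z => ∏ j, (z - ξ j) ^ (m j)

/-- A decomposition `f = a₁ g + q` with `g ∈ H²`, `deg q ≤ N − 1`, witnessing membership
in `H(b) = a₁H² ⊕ P_{N−1}`. -/
def HbDecompOf {n : ℕ} (ξ : Fin n → ℂ) (m : Fin n → ℕ)
    (f g : ℂ → ℂ) (q : Polynomial ℂ) : Prop :=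
  MemH2 g ∧ q.degree < ((∑ j, m j : ℕ) : WithBot ℕ) ∧
    ∀ z ∈ unitDisk, f z = a1fun ξ m z * g z + q.eval z

/-- Membership in `H(b) = a₁ H² ⊕ P_{N−1}` (description of `H(b)` for `b` rational,
not a finite Blaschke product, whose pythagorean mate has boundary zeros `ξ` with
multiplicities `m`). -/
def MemHb {n : ℕ} (ξ : Fin n → ℂ) (m : Fin n → ℕ) (f : ℂ → ℂ) : Prop :=
  ∃ gq : (ℂ → ℂ) × Polynomial ℂ, HbDecompOf ξ m f gq.1 gq.2

/-- The (unique) decomposition of a member of `H(b)`. -/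
def hbDecomp {n : ℕ} (ξ : Fin n → ℂ) (m : Fin n → ℕ) (f : ℂ → ℂ) :
    (ℂ → ℂ) × Polynomial ℂ :=
  if h : MemHb ξ m f then h.choose else (0, 0)

/-- The squared norm `⦀a₁g + q⦀² = ‖g‖²_{H²} + ‖q‖²_{H²}` on `H(b)`. -/
def hbNormSq {n : ℕ} (ξ : Fin n → ℂ) (m : Fin n → ℕ) (f : ℂ → ℂ) : ℝ :=
  h2NormSq (hbDecomp ξ m f).1 + h2NormSq fun z => ((hbDecomp ξ m f).2).eval z

/-- The inner product on `H(b)` induced by the decomposition. -/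
def hbInner {n : ℕ} (ξ : Fin n → ℂ) (m : Fin n → ℕ) (f g : ℂ → ℂ) : ℂ :=
  h2Inner (hbDecomp ξ m f).1 (hbDecomp ξ m g).1 +
    h2Inner (fun z => ((hbDecomp ξ m f).2).eval z)
      (fun z => ((hbDecomp ξ m g).2).eval z)

/-- The Stolz angle (non-tangential approach region) at a boundary point `ξ`. -/
def stolzAngle (ξ : ℂ) (M : ℝ) : Set ℂ := {z ∈ unitDisk | ‖z - ξ‖ ≤ M * (1 - ‖z‖)}

/-- `f` has non-tangential limit `L` at `ξ`. -/
def NTLimit (f : ℂ → ℂ) (ξ L : ℂ) : Prop :=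
  ∀ M : ℝ, 1 < M → Tendsto f (nhdsWithin ξ (stolzAngle ξ M)) (nhds L)

/-- Radial boundary value of `f` at `ζ` (junk value if the radial limit does not exist). -/
def bdryVal (f : ℂ → ℂ) (ζ : ℂ) : ℂ :=
  limUnder (nhdsWithin (1:ℝ) (Set.Iio 1)) fun r : ℝ => f ((r : ℂ) * ζ)

/-- The full setting: `b` is a rational function in the closed unit ball of `H^∞` with
`‖b‖_∞ = 1` which is not a finite Blaschke product; `a` is its pythagorean mate (rational,
outer — i.e. zero-free on the disk —, `a(0) > 0`, `|a|² + |b|² = 1` on the circle); the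
`ξ j` are the distinct zeros of `a` on the unit circle, with multiplicities `m j`. -/
structure RationalSetting (b a : ℂ → ℂ) (n : ℕ) (ξ : Fin n → ℂ) (m : Fin n → ℕ) :
    Prop where
  b_diff : DifferentiableOn ℂ b unitDisk
  b_rat : IsRationalOnDisk b
  b_le_one : ∀ z ∈ unitDisk, ‖b z‖ ≤ 1
  b_norm_one : sSup ((fun z => ‖b z‖) '' unitDisk) = 1
  b_not_fbp : ¬ IsFiniteBlaschke b
  a_diff : DifferentiableOn ℂ a unitDisk
  a_rat : IsRationalOnDisk a
  a_outer : ∀ z ∈ unitDisk, a z ≠ 0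
  a_zero_pos : 0 < (a 0).re ∧ (a 0).im = 0
  pyth : ∀ ζ ∈ unitCircle, ‖a ζ‖ ^ 2 + ‖b ζ‖ ^ 2 = 1
  zeros_mem : ∀ j, ξ j ∈ unitCircle
  zeros_inj : Function.Injective ξ
  mult_pos : ∀ j, 0 < m j
  factor : ∃ g : ℂ → ℂ, IsRationalOnDisk g ∧ (∀ ζ ∈ unitCircle, g ζ ≠ 0) ∧
    ∀ z ∈ Metric.closedBall (0:ℂ) 1, a z = a1fun ξ m z * g z

/-- The composition operator `C_φ` maps `H(b)` into itself and is bounded there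
(with respect to the equivalent norm `⦀·⦀_b`). -/
def CompBddHb {n : ℕ} (ξ : Fin n → ℂ) (m : Fin n → ℕ) (φ : ℂ → ℂ) : Prop :=
  (∀ f, MemHb ξ m f → MemHb ξ m fun z => f (φ z)) ∧
  ∃ C : ℝ, ∀ f, MemHb ξ m f →
    hbNormSq ξ m (fun z => f (φ z)) ≤ C * hbNormSq ξ m f

/-- The composition operator `C_φ` is compact on `H(b)`: it is bounded and the image of
every sequence in the unit ball has a subsequence whose image converges in `H(b)`. -/
def CompCompactHb {n : ℕ} (ξ : Fin n → ℂ) (m : Fin n → ℕ) (φ : ℂ → ℂ) : Prop :=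
  CompBddHb ξ m φ ∧
  ∀ f : ℕ → ℂ → ℂ, (∀ k, MemHb ξ m (f k) ∧ hbNormSq ξ m (f k) ≤ 1) →
    ∃ (κ : ℕ → ℕ) (g : ℂ → ℂ), StrictMono κ ∧ MemHb ξ m g ∧
      Tendsto (fun i => hbNormSq ξ m fun z => f (κ i) (φ z) - g z) atTop (nhds 0)

/-- The composition operator `C_φ` is Hilbert–Schmidt on `H(b)`: it is bounded and the sum
of `⦀C_φ e⦀²` over the orthonormal basis `{a₁ z^k}ₖ ∪ {z^j}_{j<N}` of
`(H(b), ⦀·⦀_b)` is finite (the finite part of the sum being automatically finite). -/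
def CompHSHb {n : ℕ} (ξ : Fin n → ℂ) (m : Fin n → ℕ) (φ : ℂ → ℂ) : Prop :=
  CompBddHb ξ m φ ∧
  Summable fun k : ℕ => hbNormSq ξ m fun z => a1fun ξ m (φ z) * φ z ^ k

/-- The weighted composition operator `W_{u,φ} f = u · (f ∘ φ)` maps `H²` boundedly
into itself. -/
def WCompBddH2 (u φ : ℂ → ℂ) : Prop :=
  (∀ f, MemH2 f → MemH2 fun z => u z * f (φ z)) ∧
  ∃ C : ℝ, ∀ f, MemH2 f →
    h2NormSq (fun z => u z * f (φ z)) ≤ C * h2NormSq f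

/-- The weighted composition operator `W_{u,φ}` is compact on `H²`. -/
def WCompCompactH2 (u φ : ℂ → ℂ) : Prop :=
  WCompBddH2 u φ ∧
  ∀ f : ℕ → ℂ → ℂ, (∀ k, MemH2 (f k) ∧ h2NormSq (f k) ≤ 1) →
    ∃ (κ : ℕ → ℕ) (g : ℂ → ℂ), StrictMono κ ∧ MemH2 g ∧
      Tendsto (fun i => h2NormSq fun z => u z * f (κ i) (φ z) - g z) atTop (nhds 0)

/-- The weighted composition operator `W_{u,φ}` is Hilbert–Schmidt on `H²`
(sum over the orthonormal basis `{z^k}` of `H²`). -/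
def WCompHSH2 (u φ : ℂ → ℂ) : Prop :=
  WCompBddH2 u φ ∧ Summable fun k : ℕ => h2NormSq fun z => u z * φ z ^ k

/-- The function `u = (a₁ ∘ φ) · ∏_{j ≥ p} (φ − φ(ξⱼ))^{mⱼ} / a₁`, where `Λ j = φ(ξ j)`
are the non-tangential limits of `φ` at the zeros of the mate. -/
def ufun {n : ℕ} (p : ℕ) (ξ : Fin n → ℂ) (m : Fin n → ℕ) (Λ : Fin n → ℂ)
    (φ : ℂ → ℂ) : ℂ → ℂ :=
  fun z => a1fun ξ m (φ z) *
    (∏ j ∈ Finset.univ.filter fun j : Fin n => p ≤ (j : ℕ), (φ z - Λ j) ^ (m j)) /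
      a1fun ξ m z

/-- The reproducing kernel of the de Branges–Rovnyak space `H(c)`:
`k_λ^c(z) = (1 − conj(c(λ)) c(z)) / (1 − conj(λ) z)`, as a function of the parameter `λ`
and the evaluation point `z`. -/
def rkKernel (c : ℂ → ℂ) (lam z : ℂ) : ℂ :=
  (1 - (starRingEnd ℂ) (c lam) * c z) / (1 - (starRingEnd ℂ) lam * z)

/-- `f` belongs to the reproducing kernel Hilbert space `H(c)` with squared norm at
most `t`: for all finite linear combinations of kernels,
`|⟨f, Σ αᵢ k_{λᵢ}⟩|² ≤ t · ‖Σ αᵢ k_{λᵢ}‖²`. -/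
def HbRKBound (c f : ℂ → ℂ) (t : ℝ) : Prop :=
  ∀ (k : ℕ) (lam α : Fin k → ℂ), (∀ i, lam i ∈ unitDisk) →
    ‖∑ i, (starRingEnd ℂ) (α i) * f (lam i)‖ ^ 2 ≤
      t * (∑ i, ∑ j, α i * (starRingEnd ℂ) (α j) * rkKernel c (lam i) (lam j)).re

/-- Membership in the de Branges–Rovnyak space `H(c)` (general RKHS definition). -/
def MemHbRK (c f : ℂ → ℂ) : Prop := ∃ t : ℝ, HbRKBound c f t

/-- `φ` has an angular derivative in the sense of Carathéodory at `ξ`: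
`φ` and `φ'` have non-tangential limits at `ξ` and `|φ(ξ)| = 1`. -/
def HasADC (φ : ℂ → ℂ) (ξ : ℂ) : Prop :=
  ∃ L L' : ℂ, ‖L‖ = 1 ∧ NTLimit φ ξ L ∧ NTLimit (deriv φ) ξ L'

/-- The measure `μ_{u,φ}(E) = ∫_{φ⁻¹(E) ∩ T} |u|² dm` (boundary values on the circle,
normalized Lebesgue measure). -/
def muMeas (u φ : ℂ → ℂ) (E : Set ℂ) : ENNReal :=
  (ENNReal.ofReal (2 * Real.pi))⁻¹ *
    ∫⁻ θ in Set.Ioc (0:ℝ) (2 * Real.pi),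
      (if bdryVal φ (Complex.exp (θ * Complex.I)) ∈ E then
        ENNReal.ofReal (‖bdryVal u (Complex.exp (θ * Complex.I))‖ ^ 2) else 0)

/-- `μ_{u,φ}` is a Carleson measure: `μ(S(ζ,r)) ≤ M r` for all Carleson windows
`S(ζ,r) = {z : |z| ≤ 1, |z − ζ| ≤ r}`, `ζ ∈ T`, `0 < r < 1`. -/
def IsCarleson (u φ : ℂ → ℂ) : Prop :=
  ∃ M : ℝ, 0 < M ∧ ∀ ζ ∈ unitCircle, ∀ r ∈ Set.Ioo (0:ℝ) 1,
    muMeas u φ (Metric.closedBall ζ r ∩ Metric.closedBall 0 1) ≤ ENNReal.ofReal (M * r)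

/-- `μ_{u,φ}` is a vanishing Carleson measure: `sup_{ζ∈T} μ(S(ζ,r))/r → 0` as `r → 0`. -/
def IsVanishingCarleson (u φ : ℂ → ℂ) : Prop :=
  ∀ ε > (0:ℝ), ∃ r₀ ∈ Set.Ioo (0:ℝ) 1, ∀ r ∈ Set.Ioo (0:ℝ) r₀, ∀ ζ ∈ unitCircle,
    muMeas u φ (Metric.closedBall ζ r ∩ Metric.closedBall 0 1) ≤ ENNReal.ofReal (ε * r)

/-- The reproducing kernel integral
`∫_T (1 − |w|²) |u(ξ)|² / |1 − conj(w) φ(ξ)|² dm(ξ)`. -/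
def repKerInt (u φ : ℂ → ℂ) (w : ℂ) : ENNReal :=
  (ENNReal.ofReal (2 * Real.pi))⁻¹ *
    ∫⁻ θ in Set.Ioc (0:ℝ) (2 * Real.pi),
      ENNReal.ofReal ((1 - ‖w‖ ^ 2) * ‖bdryVal u (Complex.exp (θ * Complex.I))‖ ^ 2 /
        ‖1 - (starRingEnd ℂ) w * bdryVal φ (Complex.exp (θ * Complex.I))‖ ^ 2)


section Helpers

open Asymptotics Topology Polynomial

/-- Taylor coefficients are determined by a convergent expansion. -/
lemma taylorCoeff_eq_of_hasSum {f : ℂ → ℂ} {c : ℕ → ℂ}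
    (h : ∀ z ∈ unitDisk, HasSum (fun k => c k * z ^ k) (f z)) (k : ℕ) :
    taylorCoeff f k = c k := by
  have h1 : HasFPowerSeriesAt f (FormalMultilinearSeries.ofScalars ℂ c) 0 := by
    rw [hasFPowerSeriesAt_iff]
    have : unitDisk ∈ 𝓝 (0:ℂ) := Metric.ball_mem_nhds _ one_pos
    filter_upwards [this] with z hz
    simpa [FormalMultilinearSeries.coeff_ofScalars, mul_comm] using h z hz
  have h2 := h1.analyticAt.hasFPowerSeriesAt
  have h3 := h2.eq_formalMultilinearSeries h1
  have h4 := congrArg (fun s => FormalMultilinearSeries.coeff s k) h3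
  simpa [FormalMultilinearSeries.coeff_ofScalars, taylorCoeff] using h4

lemma memH2_poly (P : ℂ[X]) : MemH2 (fun z => P.eval z) := by
  have hc : ∀ k, taylorCoeff (fun z => P.eval z) k = P.coeff k := by
    apply taylorCoeff_eq_of_hasSum
    intro z _
    simp only [Polynomial.eval_eq_sum, Polynomial.sum_def]
    apply hasSum_sum_of_ne_finset_zero
    intro k hk
    simp [Polynomial.notMem_support_iff.mp hk]
  refine ⟨P.differentiable.differentiableOn, ?_⟩
  apply summable_of_ne_finset_zero (s := P.support)
  intro k hk
  simp [hc, Polynomial.notMem_support_iff.mp hk]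

lemma norm_conj_mul_lt {ξ z : ℂ} (hξ : ‖ξ‖ = 1) (hz : z ∈ unitDisk) :
    ‖(starRingEnd ℂ) ξ * z‖ < 1 := by
  have : ‖z‖ < 1 := by simpa [unitDisk] using hz
  simpa [hξ] using this

lemma memH2_log {ξ : ℂ} (hξ : ‖ξ‖ = 1) :
    MemH2 (fun z => -Complex.log (1 - (starRingEnd ℂ) ξ * z)) := by
  have hc : ∀ k, taylorCoeff (fun z => -Complex.log (1 - (starRingEnd ℂ) ξ * z)) k
      = (starRingEnd ℂ) ξ ^ k / k := by
    apply taylorCoeff_eq_of_hasSum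
    intro z hz
    have := Complex.hasSum_taylorSeries_neg_log (norm_conj_mul_lt hξ hz)
    refine this.congr_fun ?_
    intro k
    rw [mul_pow]; ring
  constructor
  · intro z hz
    have h1 : (1 - (starRingEnd ℂ) ξ * z) ∈ Complex.slitPlane := by
      left
      have h2 := norm_conj_mul_lt hξ hz
      have h3 := Complex.re_le_norm ((starRingEnd ℂ) ξ * z)
      rw [Complex.sub_re, Complex.one_re]; linarith
    apply DifferentiableAt.differentiableWithinAt
    have : DifferentiableAt ℂ (fun z => 1 - (starRingEnd ℂ) ξ * z) z := by fun_prop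
    exact (this.clog h1).neg
  · simp only [hc]
    have := Real.summable_one_div_nat_pow.mpr (one_lt_two)
    refine this.congr ?_
    intro k
    simp [hξ]

lemma h2_growth {g : ℂ → ℂ} (hg : MemH2 g) :
    ∃ C : ℝ, 0 ≤ C ∧ ∀ z ∈ unitDisk, ‖g z‖ ≤ C / Real.sqrt (1 - ‖z‖) := by
  obtain ⟨hd, hs⟩ := hg
  set A := ∑' k, ‖taylorCoeff g k‖ ^ 2 with hA
  have hA0 : 0 ≤ A := tsum_nonneg fun k => by positivity
  refine ⟨A + 1, by positivity, ?_⟩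
  intro z hz
  have hz1 : ‖z‖ < 1 := by simpa [unitDisk] using hz
  have ht : 0 < 1 - ‖z‖ := by linarith
  set s := Real.sqrt (1 - ‖z‖) with hsd
  have hs0 : 0 < s := Real.sqrt_pos.mpr ht
  have hss : s * s = 1 - ‖z‖ := Real.mul_self_sqrt ht.le
  have h1 := Complex.hasSum_taylorSeries_on_ball (f := g) (c := 0) (r := 1)
    (by simpa [unitDisk] using hd) (z := z) (by simpa [unitDisk] using hz)
  have h2 : HasSum (fun k => s⁻¹ * ‖taylorCoeff g k‖ ^ 2 + s * ‖z‖ ^ k)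
      (s⁻¹ * A + s * (1 - ‖z‖)⁻¹) :=
    (hs.hasSum.mul_left _).add ((hasSum_geometric_of_lt_one (norm_nonneg _) hz1).mul_left _)
  have h3 : ‖g z‖ ≤ s⁻¹ * A + s * (1 - ‖z‖)⁻¹ := by
    rw [← h1.tsum_eq, ← h2.tsum_eq]
    apply tsum_of_norm_bounded h2.summable.hasSum
    intro k
    have e : ‖((k.factorial : ℂ)⁻¹ • (z - 0) ^ k • iteratedDeriv k g 0)‖
        = ‖taylorCoeff g k‖ * ‖z‖ ^ k := by
      simp [taylorCoeff]; ring
    rw [e]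
    have hx : 0 ≤ ‖z‖ ^ k := by positivity
    have hx1 : ‖z‖ ^ k ≤ 1 := pow_le_one₀ (norm_nonneg _) hz1.le
    have hy : 0 ≤ ‖taylorCoeff g k‖ := norm_nonneg _
    generalize ‖taylorCoeff g k‖ = y at *
    generalize ‖z‖ ^ k = x at *
    have hxx : x * x ≤ x := by nlinarith
    have : y * x ≤ s⁻¹ * y ^ 2 + s * (x * x) := by
      have e2 : s⁻¹ * y ^ 2 + s * (x * x) - y * x
        = s⁻¹ * ((y - s * x / 2) ^ 2 + 3 / 4 * (s * x) ^ 2) := by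
        field_simp; ring
      have : 0 ≤ s⁻¹ * ((y - s * x / 2) ^ 2 + 3 / 4 * (s * x) ^ 2) := by positivity
      linarith
    nlinarith
  refine h3.trans (le_of_eq ?_)
  rw [← hss]; field_simp

/-- The radial path. -/
def zr (ξ : ℂ) (t : ℝ) : ℂ := ((1 - t : ℝ) : ℂ) * ξ

lemma zr_sub (ξ : ℂ) (t : ℝ) : zr ξ t - ξ = -(t : ℂ) * ξ := by
  simp [zr]; ring

lemma norm_zr_sub {ξ : ℂ} (hξ : ‖ξ‖ = 1) {t : ℝ} (ht : 0 < t) : ‖zr ξ t - ξ‖ = t := by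
  rw [zr_sub]; simp [hξ, abs_of_pos ht]

lemma norm_zr {ξ : ℂ} (hξ : ‖ξ‖ = 1) {t : ℝ} (ht : t < 1) : ‖zr ξ t‖ = 1 - t := by
  rw [zr, norm_mul, hξ, mul_one, Complex.norm_real, Real.norm_of_nonneg (by linarith)]

lemma zr_mem {ξ : ℂ} (hξ : ‖ξ‖ = 1) {t : ℝ} (h0 : 0 < t) (ht : t < 1) :
    zr ξ t ∈ unitDisk := by
  simp [unitDisk, norm_zr hξ ht, h0]

lemma ev_Ioo : ∀ᶠ t : ℝ in 𝓝[>] 0, 0 < t ∧ t < 1 := by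
  filter_upwards [Ioo_mem_nhdsGT (zero_lt_one' ℝ)] with t ht using ht

lemma zr_tendsto (ξ : ℂ) : Tendsto (zr ξ) (𝓝[>] 0) (𝓝 ξ) := by
  have : Continuous (zr ξ) := by unfold zr; fun_prop
  have h := this.tendsto 0
  simp only [zr, sub_zero, Complex.ofReal_one, one_mul] at h
  exact h.mono_left nhdsWithin_le_nhds

lemma nt_radial {f : ℂ → ℂ} {ξ L : ℂ} (hξ : ‖ξ‖ = 1) (h : NTLimit f ξ L) :
    Tendsto (fun t => f (zr ξ t)) (𝓝[>] 0) (𝓝 L) := by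
  refine (h 2 (by norm_num)).comp ?_
  refine tendsto_nhdsWithin_iff.mpr ⟨zr_tendsto ξ, ?_⟩
  filter_upwards [ev_Ioo] with t ht
  refine ⟨zr_mem hξ ht.1 ht.2, ?_⟩
  rw [norm_zr_sub hξ ht.1, norm_zr hξ ht.2]; linarith

lemma poly_tendsto (q : ℂ[X]) (ξ : ℂ) :
    Tendsto (fun t => q.eval (zr ξ t)) (𝓝[>] 0) (𝓝 (q.eval ξ)) :=
  (q.continuous.tendsto ξ).comp (zr_tendsto ξ)

lemma poly_factor {q : ℂ[X]} {ξ : ℂ} {k : ℕ} (h : ¬ (X - C ξ) ^ k ∣ q) :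
    ∃ l < k, ∃ r : ℂ[X], q = (X - C ξ) ^ l * r ∧ r.eval ξ ≠ 0 := by
  have hq : q ≠ 0 := by rintro rfl; exact h (dvd_zero _)
  obtain ⟨r, hr, hnd⟩ := q.exists_eq_pow_rootMultiplicity_mul_and_not_dvd hq ξ
  refine ⟨_, ?_, r, hr, ?_⟩
  · by_contra! hk
    exact h ((pow_dvd_pow _ hk).trans ⟨r, hr⟩)
  · intro h0
    exact hnd (Polynomial.dvd_iff_isRoot.mpr h0)

lemma poly_bigO {q : ℂ[X]} {ξ : ℂ} (hξ : ‖ξ‖ = 1) {l : ℕ} (h : (X - C ξ) ^ l ∣ q) :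
    (fun t => q.eval (zr ξ t)) =O[𝓝[>] 0] fun t : ℝ => t ^ l := by
  obtain ⟨r, rfl⟩ := h
  have h1 : (fun t => r.eval (zr ξ t)) =O[𝓝[>] 0] fun _ : ℝ => (1:ℝ) :=
    (poly_tendsto r ξ).isBigO_one ℝ
  have h2 : (fun t => (zr ξ t - ξ) ^ l) =O[𝓝[>] 0] fun t : ℝ => t ^ l := by
    apply IsBigO.of_bound 1
    filter_upwards [ev_Ioo] with t ht
    rw [norm_pow, norm_zr_sub hξ ht.1, norm_pow, Real.norm_of_nonneg ht.1.le, one_mul]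
  simpa using h2.mul h1

lemma poly_lower {r : ℂ[X]} {ξ : ℂ} (hξ : ‖ξ‖ = 1) (l : ℕ) (hr : r.eval ξ ≠ 0) :
    (fun t : ℝ => t ^ l) =O[𝓝[>] 0] fun t => ((X - C ξ) ^ l * r).eval (zr ξ t) := by
  have h1 : (fun _ : ℝ => (1:ℝ)) =O[𝓝[>] 0] fun t => r.eval (zr ξ t) := by
    have := (poly_tendsto r ξ).norm.eventually_const_lt
      (half_lt_self (norm_pos_iff.mpr hr))
    apply IsBigO.of_bound (2 / ‖r.eval ξ‖)
    filter_upwards [this] with t ht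
    have h0 := norm_pos_iff.mpr hr
    rw [norm_one, div_mul_eq_mul_div, le_div_iff₀ h0]; linarith
  have h2 : (fun t : ℝ => t ^ l) =O[𝓝[>] 0] fun t => (zr ξ t - ξ) ^ l := by
    apply IsBigO.of_bound 1
    filter_upwards [ev_Ioo] with t ht
    rw [norm_pow, norm_pow, norm_zr_sub hξ ht.1, Real.norm_of_nonneg ht.1.le, one_mul]
  simpa using h2.mul h1

lemma pow_bigO {k l : ℕ} (h : l ≤ k) :
    (fun t : ℝ => t ^ k) =O[𝓝[>] 0] fun t : ℝ => t ^ l := by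
  apply IsBigO.of_bound 1
  filter_upwards [ev_Ioo] with t ht
  rw [norm_pow, norm_pow, Real.norm_of_nonneg ht.1.le, one_mul]
  exact pow_le_pow_of_le_one ht.1.le ht.2.le h

lemma pow_littleO {k l : ℕ} (h : l < k) :
    (fun t : ℝ => t ^ k) =o[𝓝[>] 0] fun t : ℝ => t ^ l :=
  (isLittleO_pow_pow h).mono nhdsWithin_le_nhds

lemma pow_not_littleO (l : ℕ) :
    ¬ (fun t : ℝ => t ^ l) =o[𝓝[>] 0] fun t : ℝ => t ^ l := by
  apply isLittleO_irrefl
  apply Eventually.frequently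
  filter_upwards [ev_Ioo] with t ht
  have := ht.1
  positivity

lemma poly_dvd {q : ℂ[X]} {ξ : ℂ} (hξ : ‖ξ‖ = 1) {k : ℕ} (hk : 0 < k)
    (h : (fun t => q.eval (zr ξ t)) =o[𝓝[>] 0] fun t : ℝ => t ^ (k - 1)) :
    (X - C ξ) ^ k ∣ q := by
  by_contra hnd
  obtain ⟨l, hl, r, rfl, hr⟩ := poly_factor hnd
  have := (poly_lower hξ l hr).trans_isLittleO (h.trans_isBigO (pow_bigO (show l ≤ k - 1 by omega)))
  exact pow_not_littleO l this

lemma hb_expand {n : ℕ} {ξ : Fin n → ℂ} {m : Fin n → ℕ} {f g : ℂ → ℂ} {q : ℂ[X]}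
    (h : HbDecompOf ξ m f g q) (j : Fin n) (hξ : ‖ξ j‖ = 1) (hm : 0 < m j) :
    (fun t => f (zr (ξ j) t) - q.eval (zr (ξ j) t)) =o[𝓝[>] 0]
      fun t : ℝ => t ^ (m j - 1) := by
  obtain ⟨hg, -, hf⟩ := h
  obtain ⟨K, hK, hgr⟩ := h2_growth hg
  set A : ℂ[X] := ∏ i, (X - C (ξ i)) ^ m i with hA
  have hAe : ∀ z, a1fun ξ m z = A.eval z := by
    intro z; simp [a1fun, hA, Polynomial.eval_prod]
  have hA1 : (fun t => A.eval (zr (ξ j) t)) =O[𝓝[>] 0] fun t : ℝ => t ^ m j :=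
    poly_bigO hξ (Finset.dvd_prod_of_mem _ (Finset.mem_univ j))
  have hg1 : (fun t : ℝ => (t:ℂ) * g (zr (ξ j) t)) =o[𝓝[>] 0] fun _ : ℝ => (1:ℝ) := by
    rw [isLittleO_one_iff]
    have hb : Tendsto (fun t : ℝ => K * Real.sqrt t) (𝓝[>] 0) (𝓝 0) := by
      have : Continuous fun t : ℝ => K * Real.sqrt t := by fun_prop
      have := this.tendsto 0
      simp only [Real.sqrt_zero, mul_zero] at this
      exact this.mono_left nhdsWithin_le_nhds
    refine squeeze_zero_norm' ?_ hb
    filter_upwards [ev_Ioo] with t ht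
    have := hgr _ (zr_mem hξ ht.1 ht.2)
    rw [norm_zr hξ ht.2, sub_sub_cancel] at this
    rw [norm_mul, Complex.norm_real, Real.norm_of_nonneg ht.1.le]
    calc t * ‖g (zr (ξ j) t)‖ ≤ t * (K / Real.sqrt t) := by gcongr; exact ht.1.le
      _ = K * (t / Real.sqrt t) := by ring
      _ = K * Real.sqrt t := by rw [Real.div_sqrt]
  have hA2 : (fun t : ℝ => A.eval (zr (ξ j) t) * (t:ℂ)⁻¹) =O[𝓝[>] 0]
      fun t : ℝ => t ^ (m j - 1) := by
    have hi : (fun t : ℝ => (t:ℂ)⁻¹) =O[𝓝[>] 0] fun t : ℝ => t⁻¹ := by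
      apply IsBigO.of_bound 1
      filter_upwards with t
      simp
    refine (hA1.mul hi).congr' EventuallyEq.rfl ?_
    filter_upwards [ev_Ioo] with t ht
    have := ht.1.ne'
    obtain ⟨k, hk⟩ : ∃ k, m j = k + 1 := ⟨m j - 1, by omega⟩
    rw [hk, pow_succ]; simp [this]
  have := hA2.mul_isLittleO hg1
  refine this.congr' ?_ ?_
  · filter_upwards [ev_Ioo] with t ht
    rw [hf _ (zr_mem hξ ht.1 ht.2), hAe]
    have : (t:ℂ) ≠ 0 := by exact_mod_cast ht.1.ne'
    field_simp; ring
  · filter_upwards with t; simp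

/-- The polynomial `a₁`. -/
def a1poly {n : ℕ} (ξ : Fin n → ℂ) (m : Fin n → ℕ) : ℂ[X] := ∏ i, (X - C (ξ i)) ^ m i

lemma a1fun_eq {n : ℕ} (ξ : Fin n → ℂ) (m : Fin n → ℕ) (z : ℂ) :
    a1fun ξ m z = (a1poly ξ m).eval z := by
  simp [a1fun, a1poly, Polynomial.eval_prod]

lemma poly_bdd_comp (P : ℂ[X]) {φ : ℂ → ℂ} {ξ L : ℂ}
    (hφ : Tendsto (fun t => φ (zr ξ t)) (𝓝[>] 0) (𝓝 L)) :
    (fun t => P.eval (φ (zr ξ t))) =O[𝓝[>] 0] fun _ : ℝ => (1:ℝ) :=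
  ((P.continuous.tendsto L).comp hφ).isBigO_one ℝ

lemma memHb_mul {n : ℕ} {ξ : Fin n → ℂ} {m : Fin n → ℕ} {g : ℂ → ℂ} (hg : MemH2 g) :
    MemHb ξ m fun z => a1fun ξ m z * g z :=
  ⟨(g, 0), hg, by rw [Polynomial.degree_zero]; exact WithBot.bot_lt_coe _, by intro z _; simp⟩

/-- Where the boundary value of `φ` is a zero of `a₁`, the function `a₁ ∘ φ` vanishes
to high order. -/
lemma key_circ {n : ℕ} {ξ : Fin n → ℂ} {m : Fin n → ℕ} {φ : ℂ → ℂ}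
    (hξ : ∀ j, ‖ξ j‖ = 1) (hm : ∀ j, 0 < m j)
    (hφmap : ∀ z ∈ unitDisk, φ z ∈ unitDisk)
    (hcomp : ∀ f, MemHb ξ m f → MemHb ξ m fun z => f (φ z))
    (j i : Fin n) (hlim : Tendsto (fun t => φ (zr (ξ j) t)) (𝓝[>] 0) (𝓝 (ξ i))) :
    (fun t => a1fun ξ m (φ (zr (ξ j) t))) =o[𝓝[>] 0] fun t : ℝ => t ^ (m j - 1) := by
  set Φ : ℝ → ℂ := fun t => φ (zr (ξ j) t) with hΦ
  set S : ℝ → ℂ := fun t => a1fun ξ m (Φ t) with hS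
  change S =o[_] _
  obtain ⟨⟨g0, q0⟩, hd0⟩ := hcomp _ (memHb_mul (ξ := ξ) (m := m) (memH2_poly 1))
  have he0 := hb_expand hd0 j (hξ j) (hm j)
  replace he0 : (fun t => S t - q0.eval (zr (ξ j) t)) =o[𝓝[>] 0]
      fun t : ℝ => t ^ (m j - 1) := by simpa [hS, hΦ] using he0
  by_cases hdv : (X - C (ξ j)) ^ m j ∣ q0
  · have := (poly_bigO (hξ j) hdv).trans_isLittleO
      (pow_littleO (show m j - 1 < m j by have := hm j; omega))
    simpa using he0.add this
  exfalso
  obtain ⟨l, hl, r, rfl, hr⟩ := poly_factor hdv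
  have hlm : l ≤ m j - 1 := by omega
  set Q := (X - C (ξ j)) ^ l * r with hQ
  -- two-sided bounds for `S`
  have hSub : S =O[𝓝[>] 0] fun t : ℝ => t ^ l := by
    have := (he0.isBigO.trans (pow_bigO hlm)).add (poly_bigO (hξ j) (Dvd.intro r rfl : _ ∣ Q))
    simpa using this
  have hSlb : (fun t : ℝ => t ^ l) =O[𝓝[>] 0] S := by
    have h1 := poly_lower (hξ j) l hr
    have h2 : (fun t => S t - Q.eval (zr (ξ j) t)) =o[𝓝[>] 0] fun t => Q.eval (zr (ξ j) t) :=
      (he0.trans_isBigO (pow_bigO hlm)).trans_isBigO h1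
    have h3 : (fun t => Q.eval (zr (ξ j) t)) =O[𝓝[>] 0] S := IsLittleO.right_isBigO_add h2 |>.trans (by
      simpa using isBigO_refl S _)
    exact h1.trans h3
  -- the distance
  set w : ℝ → ℂ := fun t => 1 - (starRingEnd ℂ) (ξ i) * Φ t with hw
  have hξi : (starRingEnd ℂ) (ξ i) * ξ i = 1 := by
    rw [Complex.conj_mul', hξ i]; simp
  have hwn : ∀ t, Φ t - ξ i = - ξ i * w t := by
    intro t
    have : - ξ i * w t = (starRingEnd ℂ) (ξ i) * ξ i * Φ t - ξ i := by simp [hw]; ring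
    rw [this, hξi, one_mul]
  have hw0 : Tendsto w (𝓝[>] 0) (𝓝 0) := by
    have := (hlim.const_mul ((starRingEnd ℂ) (ξ i))).const_sub 1
    rw [hξi, sub_self] at this
    exact this
  have hSw : S =O[𝓝[>] 0] w := by
    have hdvd : (X - C (ξ i)) ∣ a1poly ξ m :=
      (dvd_pow_self _ (hm i).ne').trans
        (Finset.dvd_prod_of_mem (fun i => (X - C (ξ i)) ^ m i) (Finset.mem_univ i))
    obtain ⟨B, hB⟩ := hdvd
    have hb := poly_bdd_comp B hlim
    have h1 : (fun t => Φ t - ξ i) =O[𝓝[>] 0] w := by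
      apply IsBigO.of_bound 1
      filter_upwards with t
      rw [hwn, norm_mul, norm_neg, hξ i]
    have := h1.mul (hb.trans (isBigO_const_const (1:ℝ) (one_ne_zero' ℂ) _))
    refine this.congr ?_ ?_
    · intro t; simp [hS, a1fun_eq, hB, hΦ]
    · intro t; simp
  have hwlb : (fun t : ℝ => t ^ l) =O[𝓝[>] 0] w := hSlb.trans hSw
  have hw_ne : ∀ᶠ t in 𝓝[>] (0:ℝ), w t ≠ 0 := by
    filter_upwards [ev_Ioo] with t ht h0
    have := norm_conj_mul_lt (hξ i) (hφmap _ (zr_mem (hξ j) ht.1 ht.2))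
    have h1 : (starRingEnd ℂ) (ξ i) * Φ t = 1 := by
      have : (1:ℂ) - (starRingEnd ℂ) (ξ i) * Φ t = 0 := h0
      exact (sub_eq_zero.mp this).symm
    rw [show φ (zr (ξ j) t) = Φ t from rfl, h1] at this
    simp at this
  have hl0 : 0 < l := by
    by_contra h
    obtain rfl : l = 0 := by omega
    have : (fun _ : ℝ => (1:ℝ)) =o[𝓝[>] 0] fun _ : ℝ => (1:ℝ) := by
      simpa using hwlb.trans_isLittleO ((isLittleO_one_iff ℝ).mpr hw0)
    exact pow_not_littleO 0 (by simpa using this)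
  -- the logarithm
  have hlogtop : Tendsto (fun t => ‖-Complex.log (w t)‖) (𝓝[>] 0) atTop := by
    have hn : Tendsto (fun t => ‖w t‖) (𝓝[>] 0) (𝓝[>] 0) := by
      refine tendsto_nhdsWithin_iff.mpr ⟨by simpa using hw0.norm, ?_⟩
      filter_upwards [hw_ne] with t ht using norm_pos_iff.mpr ht
    have h1 := tendsto_neg_atBot_atTop.comp (Real.tendsto_log_nhdsGT_zero.comp hn)
    refine tendsto_atTop_mono ?_ h1
    intro t
    have := Complex.abs_re_le_norm (-Complex.log (w t))
    rw [Complex.neg_re, Complex.log_re] at this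
    exact (le_abs_self _).trans this
  have hlogO : (fun t : ℝ => (t:ℂ) * -Complex.log (w t)) =o[𝓝[>] 0] fun _ : ℝ => (1:ℝ) := by
    rw [isLittleO_one_iff]
    obtain ⟨c, hc0, hc⟩ := hwlb.exists_pos
    have hc' := hc.bound
    have hb : Tendsto (fun t : ℝ => t * (|Real.log c| + Real.pi) - l * (Real.log t * t))
        (𝓝[>] 0) (𝓝 0) := by
      have e1 : Tendsto (fun t : ℝ => Real.log t * t) (𝓝[>] 0) (𝓝 0) := by
        simpa using tendsto_log_mul_rpow_nhdsGT_zero zero_lt_one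
      have e2 : Tendsto (fun t : ℝ => t) (𝓝[>] 0) (𝓝 0) :=
        tendsto_id.mono_left nhdsWithin_le_nhds
      simpa using (e2.mul_const (|Real.log c| + Real.pi)).sub (e1.const_mul (l:ℝ))
    refine squeeze_zero_norm' ?_ hb
    have hsmall : ∀ᶠ t in 𝓝[>] (0:ℝ), ‖w t‖ < 1 := by
      have := hw0.norm
      rw [norm_zero] at this
      exact this.eventually_lt_const one_pos
    filter_upwards [ev_Ioo, hc', hw_ne, hsmall] with t ht h1 h2 h3
    rw [norm_mul, norm_neg, Complex.norm_real, Real.norm_of_nonneg ht.1.le]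
    have hwp : 0 < ‖w t‖ := norm_pos_iff.mpr h2
    have e1 : ‖Complex.log (w t)‖ ≤ |Real.log ‖w t‖| + Real.pi := by
      have := Complex.norm_le_abs_re_add_abs_im (Complex.log (w t))
      rw [Complex.log_re, Complex.log_im] at this
      have := Complex.abs_arg_le_pi (w t)
      linarith
    have e2 : |Real.log ‖w t‖| ≤ |Real.log c| - l * Real.log t := by
      rw [abs_of_nonpos (Real.log_nonpos hwp.le h3.le)]
      rw [norm_pow, Real.norm_of_nonneg ht.1.le] at h1
      have := Real.log_le_log (pow_pos ht.1 l) h1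
      rw [Real.log_pow, Real.log_mul hc0.ne' hwp.ne'] at this
      have := le_abs_self (Real.log c)
      linarith
    have := mul_le_mul_of_nonneg_left (e1.trans (add_le_add_left e2 _)) ht.1.le
    linarith
  -- the test function
  obtain ⟨⟨g2, q2⟩, hd2⟩ := hcomp _ (memHb_mul (ξ := ξ) (m := m) (memH2_log (hξ i)))
  have he2 := hb_expand hd2 j (hξ j) (hm j)
  replace he2 : (fun t => S t * -Complex.log (w t) - q2.eval (zr (ξ j) t)) =o[𝓝[>] 0]
      fun t : ℝ => t ^ (m j - 1) := he2
  have hT : (fun t => S t * -Complex.log (w t)) =o[𝓝[>] 0] fun t : ℝ => t ^ (l - 1) := by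
    have hi : (fun t : ℝ => (t:ℂ)⁻¹) =O[𝓝[>] 0] fun t : ℝ => t⁻¹ := by
      apply IsBigO.of_bound 1
      filter_upwards with t
      simp
    have := (hSub.mul hi).mul_isLittleO hlogO
    refine this.congr' ?_ ?_
    · filter_upwards [ev_Ioo] with t ht
      have : (t:ℂ) ≠ 0 := by exact_mod_cast ht.1.ne'
      field_simp
    · filter_upwards [ev_Ioo] with t ht
      have := ht.1.ne'
      obtain ⟨k, hk⟩ : ∃ k, l = k + 1 := ⟨l - 1, by omega⟩
      rw [hk, pow_succ]; simp [this]
  have hq2 : (fun t => q2.eval (zr (ξ j) t)) =o[𝓝[>] 0] fun t : ℝ => t ^ (l - 1) := by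
    have := hT.sub (he2.trans_isBigO (pow_bigO (show l - 1 ≤ m j - 1 by omega)))
    simpa using this
  have hdv2 := poly_dvd (hξ j) hl0 hq2
  have hT2 : (fun t => S t * -Complex.log (w t)) =O[𝓝[>] 0] fun t : ℝ => t ^ l := by
    have := (he2.isBigO.trans (pow_bigO hlm)).add (poly_bigO (hξ j) hdv2)
    simpa using this
  have hT3 := hT2.trans hSlb
  obtain ⟨c, hc⟩ := hT3.bound
  have hSne : ∀ᶠ t in 𝓝[>] (0:ℝ), S t ≠ 0 := by
    obtain ⟨c, hc⟩ := hSlb.bound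
    filter_upwards [hc, ev_Ioo] with t ht ht1 h0
    rw [h0, norm_zero, mul_zero, norm_pow, Real.norm_of_nonneg ht1.1.le] at ht
    exact absurd (pow_pos ht1.1 l) (not_lt.mpr ht)
  have := (hc.and (hSne.and (hlogtop.eventually_gt_atTop c))).exists
  obtain ⟨t, h1, h2, h3⟩ := this
  rw [norm_mul, mul_comm] at h1
  exact absurd (le_of_mul_le_mul_right h1 (norm_pos_iff.mpr h2)) (not_le.mpr h3)

/-- At a boundary point where `φ` has the limit `L`, powers of `φ - L`. -/
lemma key_disk {n : ℕ} {ξ : Fin n → ℂ} {m : Fin n → ℕ} {φ : ℂ → ℂ}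
    (hξ : ∀ j, ‖ξ j‖ = 1) (hm : ∀ j, 0 < m j) (hφ : MemHb ξ m φ) {L : ℂ}
    (j : Fin n) (hlim : Tendsto (fun t => φ (zr (ξ j) t)) (𝓝[>] 0) (𝓝 L)) :
    (fun t => (φ (zr (ξ j) t) - L) ^ m j) =o[𝓝[>] 0] fun t : ℝ => t ^ (m j - 1) := by
  have hlim0 : Tendsto (fun t => φ (zr (ξ j) t) - L) (𝓝[>] 0) (𝓝 0) := by
    simpa using hlim.sub_const L
  rcases Nat.lt_or_ge 1 (m j) with h1 | h1
  · obtain ⟨⟨g, q⟩, hd⟩ := hφ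
    have he := hb_expand hd j (hξ j) (hm j)
    have hqL : q.eval (ξ j) = L := by
      have h0 : Tendsto (fun t => φ (zr (ξ j) t) - q.eval (zr (ξ j) t)) (𝓝[>] 0) (𝓝 0) := by
        refine (isLittleO_one_iff ℝ).mp (he.trans_isBigO ?_)
        simpa using pow_bigO (Nat.zero_le (m j - 1))
      have := hlim.sub h0
      simp only [sub_sub_cancel] at this
      exact tendsto_nhds_unique (poly_tendsto q (ξ j)) (by simpa using this)
    have hdv : (X - C (ξ j)) ^ 1 ∣ q - C L := by
      rw [pow_one, Polynomial.dvd_iff_isRoot]; simp [hqL]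
    have h2 : (fun t => φ (zr (ξ j) t) - L) =O[𝓝[>] 0] fun t : ℝ => t ^ 1 := by
      have := (he.isBigO.trans (pow_bigO (show 1 ≤ m j - 1 by omega))).add (poly_bigO (hξ j) hdv)
      refine this.congr_left ?_
      intro t; simp
    have h3 := h2.pow (m j)
    simp only [pow_one] at h3
    exact h3.trans_isLittleO (pow_littleO (by omega))
  · have : m j = 1 := by have := hm j; omega
    rw [this]
    simpa using (isLittleO_one_iff ℝ).mpr hlim0

end Helpers

open Polynomial in
lemma u_mem_H2_aux
    (n : ℕ) (ξ : Fin n → ℂ) (m : Fin n → ℕ)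
    (hξ : ∀ j, ‖ξ j‖ = 1) (hinj : Function.Injective ξ) (hm : ∀ j, 0 < m j)
    (φ : ℂ → ℂ) (hφb : MemHb ξ m φ)
    (hφmap : ∀ z ∈ unitDisk, φ z ∈ unitDisk)
    (Λ : Fin n → ℂ) (hΛ : ∀ j, NTLimit φ (ξ j) (Λ j))
    (p : ℕ)
    (hΛcirc : ∀ j : Fin n, (j : ℕ) < p → ∃ i, Λ j = ξ i)
    (hcomp : ∀ f, MemHb ξ m f → MemHb ξ m fun z => f (φ z)) :
    MemH2 (ufun p ξ m Λ φ) := by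
  set P : ℂ[X] := ∏ j ∈ Finset.univ.filter fun j : Fin n => p ≤ (j : ℕ),
    (X - C (Λ j)) ^ m j with hP
  have hPe : ∀ z, P.eval z = ∏ j ∈ Finset.univ.filter fun j : Fin n => p ≤ (j : ℕ),
      (z - Λ j) ^ (m j) := by
    intro z; simp [hP, Polynomial.eval_prod]
  obtain ⟨⟨g, q⟩, hd⟩ := hcomp _ (memHb_mul (ξ := ξ) (m := m) (memH2_poly P))
  have hdvd : ∀ j, (X - C (ξ j)) ^ m j ∣ q := by
    intro j
    have hlim := nt_radial (hξ j) (hΛ j)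
    have he := hb_expand hd j (hξ j) (hm j)
    apply poly_dvd (hξ j) (hm j)
    have hF : (fun t => a1fun ξ m (φ (zr (ξ j) t)) * P.eval (φ (zr (ξ j) t)))
        =o[nhdsWithin 0 (Set.Ioi 0)] fun t : ℝ => t ^ (m j - 1) := by
      rcases Nat.lt_or_ge (j:ℕ) p with hj | hj
      · obtain ⟨i, hi⟩ := hΛcirc j hj
        have hlim' := hlim
        rw [hi] at hlim'
        have := (key_circ hξ hm hφmap hcomp j i hlim').mul_isBigO (poly_bdd_comp P hlim)
        simpa using this
      · have hdv : (X - C (Λ j)) ^ m j ∣ P :=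
          Finset.dvd_prod_of_mem (fun j => (X - C (Λ j)) ^ m j) (by simp [hj])
        obtain ⟨R, hR⟩ := hdv
        have := (key_disk hξ hm hφb j hlim).mul_isBigO
          (poly_bdd_comp (a1poly ξ m * R) hlim)
        refine this.congr ?_ ?_
        · intro t; rw [hR, a1fun_eq]; simp; ring
        · intro t; simp
    simpa using hF.sub he
  have hq : q = 0 := by
    have h1 : a1poly ξ m ∣ q := by
      apply Finset.prod_dvd_of_coprime
      · intro i _ j _ hij
        exact (Polynomial.pairwise_coprime_X_sub_C hinj hij).pow
      · intro i _; exact hdvd i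
    have h2 : (a1poly ξ m).degree = ((∑ j, m j : ℕ) : WithBot ℕ) := by
      rw [a1poly, Polynomial.degree_prod]
      simp [Polynomial.degree_pow]
    apply Polynomial.eq_zero_of_dvd_of_degree_lt h1
    rw [h2]; exact hd.2.1
  obtain ⟨hg, -, hf⟩ := hd
  have hEq : Set.EqOn (ufun p ξ m Λ φ) g unitDisk := by
    intro z hz
    have hz1 : ‖z‖ < 1 := by simpa [unitDisk] using hz
    have hne : a1fun ξ m z ≠ 0 := by
      rw [a1fun, Finset.prod_ne_zero_iff]
      intro j _
      apply pow_ne_zero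
      rw [sub_ne_zero]
      rintro rfl
      rw [hξ j] at hz1; exact lt_irrefl _ hz1
    have := hf z hz
    simp only [hq, Polynomial.eval_zero, add_zero] at this
    rw [ufun, ← hPe, this, mul_div_cancel_left₀ _ hne]
  refine ⟨hg.1.congr hEq, ?_⟩
  refine hg.2.congr ?_
  intro k
  have h0 : (0:ℂ) ∈ unitDisk := Metric.mem_ball_self one_pos
  have := hEq.iteratedDeriv_of_isOpen Metric.isOpen_ball k h0
  simp only [taylorCoeff, this]

/-- Lemma 3.8. If `C_φ` is bounded on `H(b)`, then
`u = (a₁ ∘ φ) · ∏_{j>p} (φ − φ(ξⱼ))^{mⱼ} / a₁` belongs to `H²`. -/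
theorem u_mem_H2
    (b a : ℂ → ℂ) (n : ℕ) (ξ : Fin n → ℂ) (m : Fin n → ℕ)
    (hset : RationalSetting b a n ξ m)
    (φ : ℂ → ℂ) (hφb : MemHb ξ m φ) (hφball : MemBallHinf φ)
    (hφmap : ∀ z ∈ unitDisk, φ z ∈ unitDisk)
    (Λ : Fin n → ℂ) (hΛ : ∀ j, NTLimit φ (ξ j) (Λ j))
    (p : ℕ) (hp : p ≤ n)
    (hΛcirc : ∀ j : Fin n, (j : ℕ) < p → ∃ i, Λ j = ξ i)
    (hΛdisk : ∀ j : Fin n, p ≤ (j : ℕ) → Λ j ∈ unitDisk)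
    (hbdd : CompBddHb ξ m φ) :
    MemH2 (ufun p ξ m Λ φ) := by
  exact u_mem_H2_aux n ξ m (fun j => by simpa [unitCircle] using hset.zeros_mem j) hset.zeros_inj
    hset.mult_pos φ hφb hφmap Λ hΛ p hΛcirc hbdd.1

end
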